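/- Let (Ω, ℱ, P) be a probability space, let R : Ω → ℕ be a random nonnegative integer with P(R ≥ k) > 0 for every k, fix an integer n ≥ 1, set γ_k = C(n+k−1, k), and let x be a real number with |x| < 1. Define the randomly truncated estimator T = Σ_{k=0}^R γ_k x^k / P(R ≥ k). Then T is integrable and E(T) = Σ_{k=0}^∞ γ_k x^k = (1 − x)^{−n}; that is, the random-truncation estimator is unbiased for the full infinite series. -/

import Mathlib

open MeasureTheory

lemma trunc_aux {Ω : Type*} [MeasurableSpace Ω] (P : Measure Ω) [IsProbabilityMeasure P]
    (R : Ω → ℕ) (hR : Measurable R)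
    (hpos : ∀ k : ℕ, 0 < (P {ω | k ≤ R ω}).toReal) (a : ℕ → ℝ)
    (ha : Summable fun k => |a k|) :
    HasSum a (∫ ω, ∑ k ∈ Finset.range (R ω + 1), a k / (P {ω' | k ≤ R ω'}).toReal ∂P) := by
  have hm : ∀ k : ℕ, MeasurableSet {ω | k ≤ R ω} := fun k => hR measurableSet_Ici
  have hi : ∀ c : ℕ → ℝ, ∀ k : ℕ,
      ∫ ω, Set.indicator {ω | k ≤ R ω} (fun _ => c k / (P {ω' | k ≤ R ω'}).toReal) ω ∂P = c k := by
    intro c k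
    rw [integral_indicator_const _ (hm k), smul_eq_mul, Measure.real]
    have := (hpos k).ne'
    field_simp
  have key := hasSum_integral_of_summable_integral_norm (μ := P)
    (F := fun k => Set.indicator {ω | k ≤ R ω} (fun _ => a k / (P {ω' | k ≤ R ω'}).toReal))
    (fun k => (integrable_const _).indicator (hm k)) (by
      convert! ha using 2 with k
      rw [← hi (fun k => |a k|) k]
      congr 1
      ext ω
      rw [Set.indicator_apply, Set.indicator_apply]
      split_ifs
      · rw [Real.norm_eq_abs, abs_div, abs_of_pos (hpos k)]
      · simp)
  simp only [hi a] at key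
  convert! key using 3 with ω
  rw [tsum_eq_sum (s := Finset.range (R ω + 1))]
  · refine Finset.sum_congr rfl fun k hk => ?_
    rw [Set.indicator_of_mem]
    simpa [Nat.lt_succ_iff] using hk
  · intro k hk
    rw [Set.indicator_of_notMem]
    simpa [Nat.lt_succ_iff] using hk

/-- Let `R` be a random nonnegative integer on a probability space
`(Ω, ℱ, P)` with `P(R ≥ k) > 0` for all `k`, let `n ≥ 1`, `γ k = (n + k - 1).choose k`,
and let `|x| < 1`.  The randomly truncated estimator
`T = ∑_{k=0}^R γ k * x ^ k / P(R ≥ k)` is integrable and unbiased for the full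
series: `E T = ∑' k, γ k * x ^ k = (1 - x)⁻ⁿ`. -/
theorem random_truncation_unbiased
    {Ω : Type*} [MeasurableSpace Ω] (P : Measure Ω) [IsProbabilityMeasure P]
    (R : Ω → ℕ) (hR : Measurable R)
    (hpos : ∀ k : ℕ, 0 < (P {ω | k ≤ R ω}).toReal)
    (n : ℕ) (hn : 1 ≤ n) (x : ℝ) (hx : |x| < 1)
    (T : Ω → ℝ)
    (hT : ∀ ω, T ω = ∑ k ∈ Finset.range (R ω + 1),
        ((n + k - 1).choose k : ℝ) * x ^ k / (P {ω' | k ≤ R ω'}).toReal) :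
    Integrable T P ∧
      ∫ ω, T ω ∂P = ∑' k : ℕ, ((n + k - 1).choose k : ℝ) * x ^ k ∧
      ∫ ω, T ω ∂P = (1 - x) ^ (-(n : ℤ)) := by
  have hc : ∀ k : ℕ, (n + k - 1).choose k = (k + (n - 1)).choose (n - 1) := by
    intro k
    rw [show n + k - 1 = k + (n - 1) by omega]
    exact (Nat.choose_symm_add (a := k) (b := n - 1))
  have hs : HasSum (fun k : ℕ => ((n + k - 1).choose k : ℝ) * x ^ k) ((1 - x) ^ (-(n : ℤ))) := by
    have h := hasSum_choose_mul_geometric_of_norm_lt_one (n - 1) (r := x) (by simpa using hx)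
    rw [Nat.sub_add_cancel hn] at h
    simp only [hc]
    simpa using h
  have hs' : Summable (fun k : ℕ => |((n + k - 1).choose k : ℝ) * x ^ k|) := hs.summable.abs
  have h1 := trunc_aux P R hR hpos _ hs'
  have h2 := trunc_aux P R hR hpos (fun k : ℕ => |((n + k - 1).choose k : ℝ) * x ^ k|) (by simpa only [abs_abs] using hs')
  have hT' : T = fun ω => ∑ k ∈ Finset.range (R ω + 1),
        ((n + k - 1).choose k : ℝ) * x ^ k / (P {ω' | k ≤ R ω'}).toReal := funext hT
  rw [← hT'] at h1
  refine ⟨?_, h1.tsum_eq.symm, h1.unique hs⟩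
  have hint : Integrable (fun ω => ∑ k ∈ Finset.range (R ω + 1),
        |((n + k - 1).choose k : ℝ) * x ^ k| / (P {ω' | k ≤ R ω'}).toReal) P := by
    apply Integrable.of_integral_ne_zero
    have h0 := le_hasSum h2 0 (fun j _ => abs_nonneg _)
    simp only [pow_zero, Nat.choose_zero_right, Nat.cast_one, mul_one, abs_one] at h0
    exact (lt_of_lt_of_le one_pos h0).ne'
  have hTm : Measurable T := by
    rw [hT']
    exact (measurable_from_nat (f := fun m : ℕ => ∑ k ∈ Finset.range (m + 1),
        ((n + k - 1).choose k : ℝ) * x ^ k / (P {ω' | k ≤ R ω'}).toReal)).comp hR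
  refine hint.mono' hTm.aestronglyMeasurable (Filter.Eventually.of_forall fun ω => ?_)
  rw [hT ω]
  refine (norm_sum_le _ _).trans (Finset.sum_le_sum fun k _ => ?_)
  rw [Real.norm_eq_abs, abs_div, abs_of_pos (hpos k)]
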